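/- Let S_V be a set of elements of the free group F on countably many generators, and let V be the class of groups satisfying all identities w = 1 for w ∈ S_V. Suppose m ≥ 2 and G is a group generated by m elements with G ∈ V, and suppose G contains a finitely generated subgroup D of infinite index in G such that D discriminates the relatively free group of V, in the following sense: for every finite set W of elements of F such that no w ∈ W is an identity of all groups in V (i.e., for each w ∈ W there is a group H ∈ V and a homomorphism F → H sending w to a nontrivial element), there exists a homomorphism η : F → D with η(w) ≠ 1 for all w ∈ W. Then for every set S_U of elements of F, with U the class of groups satisfying all identities of S_U and UV the class of all groups having a normal subgroup in U with quotient in V, there exists a group H₀ generated by m elements with H₀ ∈ UV such that for every finite set W of elements of F in which no w is an identity of all groups in UV, there exists a homomorphism F → H₀ sending every w ∈ W to a nontrivial element. In particular, every identity holding in all m-generated groups of UV holds in all groups of UV, so the basis rank of UV is at most m. -/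

import Mathlib

/-- A group `G` satisfies all the identities `w = 1` for `w ∈ S`. -/
def Sat (S : Set (FreeGroup ℕ)) (G : Type*) [Group G] : Prop :=
  ∀ w ∈ S, ∀ φ : FreeGroup ℕ →* G, φ w = 1

/-- `G` is generated by at most `d` elements. -/
def GeneratedBy (d : ℕ) (G : Type*) [Group G] : Prop :=
  ∃ s : Finset G, s.card ≤ d ∧ Subgroup.closure (s : Set G) = ⊤

/-- `G` belongs to the product variety `U·V`, where `U` and `V` are the varieties
defined by the sets of words `SU` and `SV` respectively: `G` has a normal subgroup
belonging to `U` with quotient belonging to `V`. -/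
def MemProd (SU SV : Set (FreeGroup ℕ)) (G : Type*) [Group G] : Prop :=
  ∃ N : Subgroup G, ∃ hN : N.Normal,
    Sat SU N ∧ (haveI := hN; Sat SV (G ⧸ N))

/-- `w` is an identity of all groups of the variety defined by the set of words `S`. -/
def IsIdOf (S : Set (FreeGroup ℕ)) (w : FreeGroup ℕ) : Prop :=
  ∀ (H : Type) [Group H], Sat S H → ∀ φ : FreeGroup ℕ →* H, φ w = 1

/-- `w` is an identity of all groups of the product variety `U·V`. -/
def IsIdOfProd (SU SV : Set (FreeGroup ℕ)) (w : FreeGroup ℕ) : Prop :=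
  ∀ (H : Type) [Group H], MemProd SU SV H → ∀ φ : FreeGroup ℕ →* H, φ w = 1


open SemidirectProduct in
theorem sd_mul_left {X L G : Type*} [Group L] [Group G] [MulAction G X]
    (a b : (X → L) ⋊[mulAutArrow] G) (x : X) :
    (a * b).left x = a.left x * b.left (a.right⁻¹ • x) := rfl

theorem sd_inv_left {X L G : Type*} [Group L] [Group G] [MulAction G X]
    (a : (X → L) ⋊[mulAutArrow] G) (x : X) :
    (a⁻¹).left x = (a.left (a.right • x))⁻¹ := by
  have h := sd_mul_left a⁻¹ a x
  rw [inv_mul_cancel] at h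
  have h1 : (1 : (X → L) ⋊[mulAutArrow] G).left x = 1 := rfl
  rw [h1] at h
  simpa using eq_inv_of_mul_eq_one_left h.symm

open Classical in
/-- The labelling homomorphism of the coset graph with a set of trivial labels. -/
noncomputable def lab {α : Type*} (P : Subgroup (FreeGroup α)) (E : Finset (FreeGroup α ⧸ P)) :
    FreeGroup α →* ((FreeGroup α ⧸ P → FreeGroup α) ⋊[mulAutArrow] FreeGroup α) :=
  FreeGroup.lift (fun i => ⟨fun x => if x ∈ E then 1 else FreeGroup.of i, FreeGroup.of i⟩)

theorem lab_right {α : Type*} (P : Subgroup (FreeGroup α)) (E : Finset (FreeGroup α ⧸ P))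
    (u : FreeGroup α) : (lab P E u).right = u := by
  have : (SemidirectProduct.rightHom.comp (lab P E)) = MonoidHom.id _ := by
    ext i
    simp [lab]
  exact DFunLike.congr_fun this u

theorem lab_mul {α : Type*} (P : Subgroup (FreeGroup α)) (E : Finset (FreeGroup α ⧸ P))
    (u v : FreeGroup α) (x) :
    (lab P E (u * v)).left x = (lab P E u).left x * (lab P E v).left (u⁻¹ • x) := by
  rw [map_mul, sd_mul_left, lab_right]

theorem lab_inv {α : Type*} (P : Subgroup (FreeGroup α)) (E : Finset (FreeGroup α ⧸ P))
    (u : FreeGroup α) (x) :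
    (lab P E u⁻¹).left x = ((lab P E u).left (u • x))⁻¹ := by
  rw [map_inv, sd_inv_left, lab_right]

theorem lab_far {α : Type*} (P : Subgroup (FreeGroup α)) (E : Finset (FreeGroup α ⧸ P))
    (u : FreeGroup α) : ∃ S : Set (FreeGroup α ⧸ P), S.Finite ∧
      ∀ x, x ∉ S → (lab P E u).left x = u := by
  induction u using FreeGroup.induction_on with
  | C1 => exact ⟨∅, Set.finite_empty, fun x _ => by rw [map_one]; rfl⟩
  | of i =>
    refine ⟨E, E.finite_toSet, fun x hx => ?_⟩
    have : x ∉ E := by simpa using hx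
    simp [lab, this]
  | inv_of i ih =>
    obtain ⟨S, hS, h⟩ := ih
    refine ⟨(fun x => (FreeGroup.of i)⁻¹ • x) '' S, hS.image _, fun x hx => ?_⟩
    have := h (FreeGroup.of i • x) (fun hc => hx ⟨_, hc, by simp⟩)
    exact (lab_inv P E (FreeGroup.of i) x).trans (congrArg _ this)
  | mul u v hu hv =>
    obtain ⟨S, hS, h⟩ := hu
    obtain ⟨S', hS', h'⟩ := hv
    refine ⟨S ∪ (fun x => u • x) '' S', hS.union (hS'.image _), fun x hx => ?_⟩
    rw [lab_mul, h x (fun hc => hx (Or.inl hc)), h' _ (fun hc => hx (Or.inr ⟨_, hc, by simp⟩))]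

theorem lab_near {α : Type*} (P : Subgroup (FreeGroup α)) 
    (u : FreeGroup α) : ∀ x, ∃ E₀ : Finset (FreeGroup α ⧸ P), 
      ∀ E, E₀ ⊆ E → (lab P E u).left x = 1 := by
  classical
  induction u using FreeGroup.induction_on with
  | C1 => exact fun x => ⟨∅, fun E _ => by rw [map_one]; rfl⟩
  | of i =>
    refine fun x => ⟨{x}, fun E hE => ?_⟩
    have : x ∈ E := by simpa using hE
    simp [lab, this]
  | inv_of i ih =>
    intro x
    obtain ⟨E₀, h⟩ := ih (FreeGroup.of i • x)
    refine ⟨E₀, fun E hE => ?_⟩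
    exact (lab_inv P E (FreeGroup.of i) x).trans (by rw [h E hE, inv_one])
  | mul u v hu hv =>
    intro x
    obtain ⟨S, h⟩ := hu x
    obtain ⟨S', h'⟩ := hv (u⁻¹ • x)
    refine ⟨S ∪ S', fun E hE => ?_⟩
    rw [lab_mul, h E (Finset.union_subset_left hE), h' E (Finset.union_subset_right hE), one_mul]

/-- A subgroup of infinite index in a free group which contains a nontrivial normal
subgroup is not finitely generated. -/
theorem not_fg_of_normal {α : Type*} (P N : Subgroup (FreeGroup α)) (hNn : N.Normal)
    (hNP : N ≤ P) (hN : N ≠ ⊥) (hP : P.index = 0) : ¬ P.FG := by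
  classical
  rintro ⟨S, hS⟩
  have hinf : Infinite (FreeGroup α ⧸ P) := by
    by_contra hc
    rw [not_infinite_iff_finite] at hc
    exact Subgroup.index_ne_zero_of_finite (H := P) hP
  set x₀ : FreeGroup α ⧸ P := ((1 : FreeGroup α) : FreeGroup α ⧸ P) with hx₀
  have hfix : ∀ p ∈ P, p • x₀ = x₀ := by
    intro p hp
    rw [hx₀, MulAction.Quotient.smul_coe, QuotientGroup.eq]
    simpa using hp
  choose E₀ hE₀ using fun u => lab_near P u x₀
  set E := S.biUnion E₀
  have htriv : ∀ p ∈ P, (lab P E p).left x₀ = 1 := by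
    intro p hp
    rw [← hS] at hp
    have key : p ∈ P ∧ (lab P E p).left x₀ = 1 := by
      induction hp using Subgroup.closure_induction with
      | mem x hx =>
        exact ⟨hS ▸ Subgroup.subset_closure hx,
          hE₀ x E (Finset.subset_biUnion_of_mem E₀ (by simpa using hx))⟩
      | one => exact ⟨P.one_mem, by rw [map_one]; rfl⟩
      | mul x y _ _ hx hy =>
        refine ⟨P.mul_mem hx.1 hy.1, ?_⟩
        rw [lab_mul, hfix _ (P.inv_mem hx.1), hx.2, hy.2, one_mul]
      | inv x _ hx =>
        refine ⟨P.inv_mem hx.1, ?_⟩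
        rw [lab_inv, hfix _ hx.1, hx.2, inv_one]
    exact key.2
  obtain ⟨r, hr, hr1⟩ := N.bot_or_exists_ne_one.resolve_left hN
  obtain ⟨T, hT, hfar⟩ := lab_far P E r
  obtain ⟨x, hx⟩ := hT.exists_notMem
  obtain ⟨v, rfl⟩ := QuotientGroup.mk_surjective x
  -- the point is `v • x₀`
  have hv : (v : FreeGroup α ⧸ P) = v • x₀ := by
    rw [hx₀, MulAction.Quotient.smul_coe]; simp
  have hrv : r⁻¹ • (v : FreeGroup α ⧸ P) = v := by
    rw [MulAction.Quotient.smul_coe, QuotientGroup.eq]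
    apply hNP
    simpa [mul_assoc] using hNn.conj_mem r hr v⁻¹
  have h1 := htriv (v⁻¹ * (r * v)) (hNP (by simpa [mul_assoc] using hNn.conj_mem r hr v⁻¹))
  have h2 := htriv (v⁻¹ * v) (by simp)
  rw [lab_mul, inv_inv, ← hv] at h1 h2
  rw [lab_mul, hrv, hfar _ hx] at h1
  apply hr1
  have h3 := h1.trans h2.symm
  simpa using h3

theorem exists_infinite_basis {α : Type} (P : Subgroup (FreeGroup α)) (hP : ¬ P.FG) :
    ∃ (B : Type) (_ : Infinite B), Nonempty (FreeGroup B ≃* P) := by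
  refine ⟨IsFreeGroup.Generators P, ?_, ⟨(IsFreeGroup.mulEquiv P)⟩⟩
  by_contra hc
  rw [not_infinite_iff_finite] at hc
  apply hP
  rw [← Group.fg_iff_subgroup_fg]
  exact Group.fg_of_surjective (f := (IsFreeGroup.mulEquiv P).toMonoidHom)
    (IsFreeGroup.mulEquiv P).surjective

theorem mem_closure_finset {B : Type*} (u : FreeGroup B) :
    ∃ E : Finset B, u ∈ Subgroup.closure (FreeGroup.of '' (E : Set B)) := by
  classical
  induction u using FreeGroup.induction_on with
  | C1 => exact ⟨∅, Subgroup.one_mem _⟩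
  | of i => exact ⟨{i}, Subgroup.subset_closure ⟨i, by simp, rfl⟩⟩
  | inv_of i ih => exact ⟨ih.choose, Subgroup.inv_mem _ ih.choose_spec⟩
  | mul u v hu hv =>
    obtain ⟨S, h⟩ := hu
    obtain ⟨S', h'⟩ := hv
    refine ⟨S ∪ S', Subgroup.mul_mem _ (Subgroup.closure_mono (Set.image_mono ?_) h)
      (Subgroup.closure_mono (Set.image_mono ?_) h')⟩ <;> simp

theorem lift_through {B D L : Type*} [Infinite B] [Group D] [Group L] [hD : Group.FG D]
    (σ : FreeGroup B →* D) (hσ : Function.Surjective σ) (τ : L →* D) (s : D →* L)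
    (hs : ∀ d, τ (s d) = d) (ξ : FreeGroup ℕ →* L) :
    ∃ (κ : FreeGroup ℕ →* FreeGroup B) (Θ : FreeGroup B →* L),
      (∀ u, τ (Θ u) = σ u) ∧ ∀ w, Θ (κ w) = ξ w := by
  classical
  obtain ⟨S, hS⟩ := hD.out
  choose g hg using hσ
  choose E hE using mem_closure_finset (B := B)
  set B₀ : Finset B := S.biUnion (fun d => E (g d)) with hB₀
  set C := Subgroup.closure (FreeGroup.of '' (B₀ : Set B)) with hC
  have hCs : ∀ d, ∃ q ∈ C, σ q = d := by
    have : C.map σ = ⊤ := by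
      rw [eq_top_iff, ← hS, Subgroup.closure_le]
      intro d hd
      refine ⟨g d, ?_, hg d⟩
      refine Subgroup.closure_mono (Set.image_mono ?_) (hE (g d))
      exact_mod_cast Finset.subset_biUnion_of_mem (fun d => E (g d)) (by simpa using hd)
    intro d
    have hd : d ∈ C.map σ := this ▸ Subgroup.mem_top d
    exact hd
  have : Infinite ((B₀ : Set B)ᶜ : Set B) := (B₀.finite_toSet.infinite_compl).to_subtype
  let y : ℕ → B := fun i => (Infinite.natEmbedding ((B₀ : Set B)ᶜ : Set B) i).1
  have hy : Function.Injective y := fun i j h =>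
    (Infinite.natEmbedding ((B₀ : Set B)ᶜ : Set B)).injective (Subtype.ext h)
  have hyB : ∀ i, y i ∉ B₀ := fun i => by
    exact fun hc => (Infinite.natEmbedding ((B₀ : Set B)ᶜ : Set B) i).2 (by exact_mod_cast hc)
  choose q hqC hq using fun i => hCs ((σ (FreeGroup.of (y i)))⁻¹ * τ (ξ (FreeGroup.of i)))
  let t : B → L := fun b => if h : ∃ i, y i = b then
    ξ (FreeGroup.of h.choose) * (s (σ (q h.choose)))⁻¹ else s (σ (FreeGroup.of b))
  have ht : ∀ i, t (y i) = ξ (FreeGroup.of i) * (s (σ (q i)))⁻¹ := by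
    intro i
    have h : ∃ j, y j = y i := ⟨i, rfl⟩
    have hc : h.choose = i := hy h.choose_spec
    simp only [t, dif_pos h, hc]
  have ht' : ∀ b, (¬ ∃ i, y i = b) → t b = s (σ (FreeGroup.of b)) := by
    intro b h
    simp only [t, dif_neg h]
  let Θ := FreeGroup.lift t
  have hΘC : ∀ u ∈ C, Θ u = s (σ u) := by
    have : C ≤ (Θ.eqLocus (s.comp σ)) := by
      rw [hC, Subgroup.closure_le]
      rintro _ ⟨b, hb, rfl⟩
      change Θ _ = s (σ _)
      simp only [Θ, FreeGroup.lift_apply_of]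
      apply ht'
      rintro ⟨i, rfl⟩
      exact hyB i (by simpa using hb)
    exact fun u hu => this hu
  refine ⟨FreeGroup.lift (fun i => FreeGroup.of (y i) * q i), Θ, ?_, ?_⟩
  · have : τ.comp Θ = σ := by
      ext b
      simp only [MonoidHom.comp_apply, Θ, FreeGroup.lift_apply_of]
      by_cases h : ∃ i, y i = b
      · obtain ⟨i, rfl⟩ := h
        rw [ht, map_mul, map_inv, hs, hq]
        group
      · rw [ht' b h, hs]
    exact fun u => DFunLike.congr_fun this u
  · have : Θ.comp (FreeGroup.lift (fun i => FreeGroup.of (y i) * q i)) = ξ := by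
      ext i
      simp only [MonoidHom.comp_apply, FreeGroup.lift_apply_of, map_mul, hΘC _ (hqC i)]
      simp only [Θ, FreeGroup.lift_apply_of, ht]
      group
    exact fun u => DFunLike.congr_fun this u

/-- The homomorphism of the free group to a wreath product with prescribed coordinates. -/
def wr {D L : Type*} [Group D] [Group L] (f : ℕ → D → L) (η : FreeGroup ℕ →* D) :
    FreeGroup ℕ →* ((D → L) ⋊[mulAutArrow] D) :=
  FreeGroup.lift (fun i => ⟨f i, η (FreeGroup.of i)⟩)

section wr
variable {D Q L : Type*} [Group D] [Group Q] [Group L]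

theorem wr_right (f : ℕ → D → L) (η : FreeGroup ℕ →* D) (u : FreeGroup ℕ) :
    (wr f η u).right = η u := by
  have : (SemidirectProduct.rightHom.comp (wr f η)) = η := by
    ext i
    simp [wr]
  exact DFunLike.congr_fun this u

theorem wr_of (f : ℕ → D → L) (η : FreeGroup ℕ →* D) (i : ℕ) :
    (wr f η (FreeGroup.of i)).left = f i := by
  simp [wr]

theorem wr_mul (f : ℕ → D → L) (η : FreeGroup ℕ →* D) (u v : FreeGroup ℕ) (x : D) :
    (wr f η (u * v)).left x = (wr f η u).left x * (wr f η v).left ((η u)⁻¹ * x) := by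
  rw [map_mul, sd_mul_left, wr_right, smul_eq_mul]

theorem wr_inv (f : ℕ → D → L) (η : FreeGroup ℕ →* D) (u : FreeGroup ℕ) (x : D) :
    (wr f η u⁻¹).left x = ((wr f η u).left (η u * x))⁻¹ := by
  rw [map_inv, sd_inv_left, wr_right, smul_eq_mul]

theorem wr_transfer (D : Type*) [Group D] (f : ℕ → Q → L) (ψ : FreeGroup ℕ →* Q)
    (w : FreeGroup ℕ) :
    ∀ g : FreeGroup ℕ, ∃ E : Finset (FreeGroup ℕ), ∀ (η : FreeGroup ℕ →* D) (f' : ℕ → D → L),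
      (∀ h ∈ E, ∀ i, f' i (η h) = f i (ψ h)) →
        (wr f' η w).left (η g) = (wr f ψ w).left (ψ g) := by
  classical
  induction w using FreeGroup.induction_on with
  | C1 => exact fun g => ⟨∅, fun η f' _ => by rw [map_one, map_one]; rfl⟩
  | of i =>
    refine fun g => ⟨{g}, fun η f' h => ?_⟩
    have h1 := h g (by simp) i
    exact (congrFun (wr_of f' η i) _).trans (h1.trans (congrFun (wr_of f ψ i) _).symm)
  | inv_of i ih =>
    intro g
    obtain ⟨E, hE⟩ := ih (FreeGroup.of i * g)
    refine ⟨E, fun η f' h => ?_⟩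
    have h1 := hE η f' h
    rw [map_mul, map_mul] at h1
    exact (wr_inv f' η (FreeGroup.of i) _).trans
      ((congrArg _ h1).trans (wr_inv f ψ (FreeGroup.of i) _).symm)
  | mul u v hu hv =>
    intro g
    obtain ⟨S, h⟩ := hu g
    obtain ⟨S', h'⟩ := hv (u⁻¹ * g)
    refine ⟨S ∪ S', fun η f' hE => ?_⟩
    have h1 := h η f' (fun x hx => hE x (Finset.mem_union_left _ hx))
    have h2 := h' η f' (fun x hx => hE x (Finset.mem_union_right _ hx))
    rw [map_mul, map_mul, map_inv, map_inv] at h2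
    rw [wr_mul, wr_mul, h1, h2]

end wr

theorem kk_mem {K : Type*} [Group K] (N : Subgroup K) [N.Normal] (k : K) (x : K ⧸ N) :
    (x.out)⁻¹ * k * ((k : K ⧸ N)⁻¹ * x).out ∈ N := by
  rw [← QuotientGroup.eq_one_iff]
  simp

/-- Kaloujnine–Krasner cocycle. -/
noncomputable def kk {K : Type*} [Group K] (N : Subgroup K) [N.Normal] (ψ : FreeGroup ℕ →* K) :
    ℕ → K ⧸ N → N := fun i x =>
  ⟨(x.out)⁻¹ * ψ (FreeGroup.of i) * ((ψ (FreeGroup.of i) : K ⧸ N)⁻¹ * x).out,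
    kk_mem N (ψ (FreeGroup.of i)) x⟩

theorem kk_spec {K : Type*} [Group K] (N : Subgroup K) [N.Normal] (ψ : FreeGroup ℕ →* K)
    (u : FreeGroup ℕ) : ∀ x : K ⧸ N,
    (((wr (kk N ψ) ((QuotientGroup.mk' N).comp ψ) u).left x : N) : K) =
      (x.out)⁻¹ * ψ u * ((ψ u : K ⧸ N)⁻¹ * x).out := by
  induction u using FreeGroup.induction_on with
  | C1 =>
    intro x
    rw [map_one, map_one]
    simp
  | of i =>
    intro x
    have := congrFun (wr_of (kk N ψ) ((QuotientGroup.mk' N).comp ψ) i) x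
    exact congrArg Subtype.val this
  | inv_of i ih =>
    intro x
    have h := wr_inv (kk N ψ) ((QuotientGroup.mk' N).comp ψ) (FreeGroup.of i) x
    have h2 := congrArg Subtype.val h
    refine h2.trans ?_
    rw [Subgroup.coe_inv, ih]
    change _ = (x.out)⁻¹ * ψ (FreeGroup.of i)⁻¹ * ((ψ (FreeGroup.of i)⁻¹ : K ⧸ N)⁻¹ * x).out
    simp [mul_assoc]
  | mul u v hu hv =>
    intro x
    rw [wr_mul, Subgroup.coe_mul, hu, hv]
    simp [mul_assoc]

/-- Sets of non-identities of the product are detected in one wreath product over `D`. -/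
theorem wreath_detects (SU SV : Set (FreeGroup ℕ)) (D : Type) [Group D]
    (hdisc : ∀ W : Finset (FreeGroup ℕ), (∀ w ∈ W, ¬ IsIdOf SV w) →
      ∃ η : FreeGroup ℕ →* D, ∀ w ∈ W, η w ≠ 1)
    (K : Type) [Group K] (hK : MemProd SU SV K) (ψ : FreeGroup ℕ →* K)
    (W : Finset (FreeGroup ℕ)) (hW : ∀ w ∈ W, ψ w ≠ 1) :
    ∃ (L : Type) (_ : Group L), Sat SU L ∧
      ∃ ξ : FreeGroup ℕ →* ((D → L) ⋊[mulAutArrow] D), ∀ w ∈ W, ξ w ≠ 1 := by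
  classical
  obtain ⟨N, hN, hU, hV⟩ := hK
  set φ := (QuotientGroup.mk' N).comp ψ with hφ
  choose E hE using fun w => wr_transfer D (kk N ψ) φ w 1
  set T := W.biUnion E with hT
  obtain ⟨η, hη⟩ := hdisc ((W ∪ Finset.image₂ (fun a b => a⁻¹ * b) T T).filter
      (fun w => φ w ≠ 1)) (by
    intro w hw hid
    exact (Finset.mem_filter.1 hw).2 (hid _ hV φ))
  have hinj : ∀ a ∈ T, ∀ b ∈ T, η a = η b → φ a = φ b := by
    intro a ha b hb hab
    by_contra hc
    refine hη (a⁻¹ * b) (Finset.mem_filter.2 ⟨Finset.mem_union_right _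
      (Finset.mem_image₂_of_mem ha hb), ?_⟩) ?_
    · rw [map_mul, map_inv, Ne, inv_mul_eq_one]; exact hc
    · rw [map_mul, map_inv, inv_mul_eq_one]; exact hab
  let f' : ℕ → D → N := fun i d =>
    if h : ∃ a ∈ T, η a = d then kk N ψ i (φ h.choose) else 1
  have hf' : ∀ a ∈ T, ∀ i, f' i (η a) = kk N ψ i (φ a) := by
    intro a ha i
    have h : ∃ b ∈ T, η b = η a := ⟨a, ha, rfl⟩
    have h2 : φ h.choose = φ a := hinj _ h.choose_spec.1 _ ha h.choose_spec.2
    simp only [f', dif_pos h, h2]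
  refine ⟨N, inferInstance, hU, wr f' η, fun w hw h1 => ?_⟩
  by_cases hc : φ w = 1
  · have h2 := hE w η f' (fun a ha => hf' a (Finset.mem_biUnion.2 ⟨w, hw, ha⟩))
    rw [h1] at h2
    have h3 := kk_spec N ψ w (φ 1)
    rw [← hφ, ← h2] at h3
    have h4 : (ψ w : K ⧸ N) = 1 := hc
    rw [h4] at h3
    have h5 : (1 : K) = ((φ 1).out)⁻¹ * ψ w * (φ 1).out := by simpa using h3
    apply hW w hw
    have h6 : ψ w = (φ 1).out * (((φ 1).out)⁻¹ * ψ w * (φ 1).out) * ((φ 1).out)⁻¹ := by group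
    rw [h6, ← h5]; simp
  · refine hη w (Finset.mem_filter.2 ⟨Finset.mem_union_left _ hw, hc⟩) ?_
    rw [← wr_right f' η, h1]; rfl

theorem lift_hom {A B : Type*} [Group A] [Group B] (f : A →* B) (hf : Function.Surjective f)
    (φ : FreeGroup ℕ →* B) : ∃ φ' : FreeGroup ℕ →* A, f.comp φ' = φ := by
  choose g hg using hf
  exact ⟨FreeGroup.lift (fun i => g (φ (FreeGroup.of i))), by ext i; simp [hg]⟩

theorem sat_of_surj {S : Set (FreeGroup ℕ)} {A B : Type*} [Group A] [Group B] (f : A →* B)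
    (hf : Function.Surjective f) (hA : Sat S A) : Sat S B := by
  intro w hw φ
  obtain ⟨φ', rfl⟩ := lift_hom f hf φ
  simp [hA w hw φ']

theorem sat_of_inj {S : Set (FreeGroup ℕ)} {A B : Type*} [Group A] [Group B] (f : A →* B)
    (hf : Function.Injective f) (hB : Sat S B) : Sat S A := by
  intro w hw φ
  exact hf (by simpa using hB w hw (f.comp φ))

theorem sat_pi {S : Set (FreeGroup ℕ)} {ι : Type*} {A : ι → Type*} [∀ i, Group (A i)]
    (h : ∀ i, Sat S (A i)) : Sat S (∀ i, A i) := by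
  intro w hw φ
  funext i
  exact h i w hw ((Pi.evalMonoidHom A i).comp φ)

/-- Membership in the product, given by a homomorphism. -/
theorem memProd_of_hom {SU SV : Set (FreeGroup ℕ)} {K Q : Type*} [Group K] [Group Q]
    (f : K →* Q) (hQ : Sat SV Q) (hU : Sat SU f.ker) : MemProd SU SV K := by
  refine ⟨f.ker, inferInstance, hU, ?_⟩
  exact sat_of_inj (QuotientGroup.kerLift f) (QuotientGroup.kerLift_injective f) hQ

theorem memProd_pi {SU SV : Set (FreeGroup ℕ)} {ι : Type*} {A : ι → Type*} [∀ i, Group (A i)]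
    (h : ∀ i, MemProd SU SV (A i)) : MemProd SU SV (∀ i, A i) := by
  choose N hN hU hV using h
  let f : (∀ i, A i) →* (∀ i, A i ⧸ N i) :=
    Pi.monoidHom (fun i => (QuotientGroup.mk' (N i)).comp (Pi.evalMonoidHom A i))
  refine memProd_of_hom f (sat_pi hV) ?_
  have hk : ∀ x : f.ker, ∀ i, x.1 i ∈ N i := by
    intro x i
    have := congrFun (MonoidHom.mem_ker.1 x.2) i
    exact (QuotientGroup.eq_one_iff _).1 this
  let g : f.ker →* (∀ i, N i) :=
    { toFun := fun x i => ⟨x.1 i, hk x i⟩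
      map_one' := rfl
      map_mul' := fun _ _ => rfl }
  refine sat_of_inj g ?_ (sat_pi hU)
  intro x y hxy
  ext i
  exact congrArg Subtype.val (congrFun hxy i)

theorem exists_common {SU SV : Set (FreeGroup ℕ)} (W : Finset (FreeGroup ℕ))
    (hW : ∀ w ∈ W, ¬ IsIdOfProd SU SV w) :
    ∃ (K : Type) (_ : Group K), MemProd SU SV K ∧
      ∃ ψ : FreeGroup ℕ →* K, ∀ w ∈ W, ψ w ≠ 1 := by
  have h : ∀ w : W, ∃ (H : Type) (_ : Group H), MemProd SU SV H ∧
      ∃ φ : FreeGroup ℕ →* H, φ w ≠ 1 := by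
    intro w
    have := hW w w.2
    unfold IsIdOfProd at this
    push Not at this
    obtain ⟨H, hH, h1, φ, h2⟩ := this
    exact ⟨H, hH, h1, φ, h2⟩
  choose H hH h1 φ h2 using h
  refine ⟨∀ w, H w, inferInstance, memProd_pi h1, Pi.monoidHom φ, fun w hw hc => ?_⟩
  exact h2 ⟨w, hw⟩ (congrFun hc ⟨w, hw⟩)

/-- The verbal subgroup of a normal subgroup `R`, as a subgroup of the whole group. -/
def verb (SU : Set (FreeGroup ℕ)) {F : Type*} [Group F] (R : Subgroup F) : Subgroup F :=
  Subgroup.closure {x | ∃ w ∈ SU, ∃ φ : FreeGroup ℕ →* R, x = φ w}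

theorem verb_le (SU : Set (FreeGroup ℕ)) {F : Type*} [Group F] (R : Subgroup F) :
    verb SU R ≤ R := by
  rw [verb, Subgroup.closure_le]
  rintro _ ⟨w, _, φ, rfl⟩
  exact (φ w).2

theorem verb_normal (SU : Set (FreeGroup ℕ)) {F : Type*} [Group F] (R : Subgroup F)
    [R.Normal] : (verb SU R).Normal := by
  constructor
  intro n hn g
  have : verb SU R ≤ (verb SU R).comap (MulAut.conj g).toMonoidHom := by
    conv_lhs => rw [verb]
    rw [Subgroup.closure_le]
    rintro _ ⟨w, hw, φ, rfl⟩
    refine Subgroup.subset_closure ⟨w, hw, (MulAut.conjNormal g).toMonoidHom.comp φ, ?_⟩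
    simp
  exact this hn

/-- The first case: the relations are nontrivial. -/
theorem case_rel (SV : Set (FreeGroup ℕ)) (m : ℕ)
    (G : Type) [Group G] (hGV : Sat SV G)
    (D : Subgroup G) (hDfg : D.FG) (hDinf : D.index = 0)
    (hdisc : ∀ W : Finset (FreeGroup ℕ), (∀ w ∈ W, ¬ IsIdOf SV w) →
      ∃ η : FreeGroup ℕ →* D, ∀ w ∈ W, η w ≠ 1)
    (SU : Set (FreeGroup ℕ)) (ρ : FreeGroup (Fin m) →* G) (hρ : Function.Surjective ρ)
    (hR : ρ.ker ≠ ⊥) :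
    (∃ (H₀ : Type) (hH : Group H₀), haveI := hH;
      GeneratedBy m H₀ ∧ MemProd SU SV H₀ ∧
        ∀ W : Finset (FreeGroup ℕ), (∀ w ∈ W, ¬ IsIdOfProd SU SV w) →
          ∃ η : FreeGroup ℕ →* H₀, ∀ w ∈ W, η w ≠ 1) := by
  classical
  have hn := verb_normal SU ρ.ker
  refine ⟨FreeGroup (Fin m) ⧸ verb SU ρ.ker, inferInstance, ?_, ?_, ?_⟩
  · refine ⟨Finset.univ.image
      (fun i => QuotientGroup.mk' (verb SU ρ.ker) (FreeGroup.of i)), ?_, ?_⟩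
    · exact Finset.card_image_le.trans (by simp)
    · have h1 : (((Finset.univ.image
          (fun i => QuotientGroup.mk' (verb SU ρ.ker) (FreeGroup.of i))) : Finset _) : Set _)
          = (QuotientGroup.mk' (verb SU ρ.ker)) '' (Set.range FreeGroup.of) := by
        ext x; simp
      rw [h1, ← MonoidHom.map_closure, FreeGroup.closure_range_of,
        ← MonoidHom.range_eq_map, MonoidHom.range_eq_top]
      exact QuotientGroup.mk'_surjective _
  · let f : FreeGroup (Fin m) ⧸ verb SU ρ.ker →* G :=
      QuotientGroup.lift _ ρ (fun x hx => verb_le SU ρ.ker hx)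
    refine memProd_of_hom f hGV ?_
    intro w hw φ
    let g : ρ.ker →* f.ker :=
      { toFun := fun x => ⟨QuotientGroup.mk' _ x.1, x.2⟩
        map_one' := rfl
        map_mul' := fun _ _ => rfl }
    have hg : Function.Surjective g := by
      rintro ⟨y, hy⟩
      obtain ⟨x, rfl⟩ := QuotientGroup.mk'_surjective _ y
      exact ⟨⟨x, hy⟩, rfl⟩
    obtain ⟨φ', rfl⟩ := lift_hom g hg φ
    apply Subtype.ext
    change QuotientGroup.mk' _ (φ' w).1 = 1
    rw [QuotientGroup.mk'_apply, QuotientGroup.eq_one_iff]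
    exact Subgroup.subset_closure ⟨w, hw, φ', rfl⟩
  · intro W hW
    obtain ⟨K, _, hK, ψ, hψ⟩ := exists_common W hW
    obtain ⟨L, _, hL, ξ, hξ⟩ := wreath_detects SU SV D hdisc K hK ψ W hψ
    set P := D.comap ρ with hP
    have hRP : ρ.ker ≤ P := fun x hx => by
      rw [hP, Subgroup.mem_comap, MonoidHom.mem_ker.1 hx]; exact D.one_mem
    have hPfg : ¬ P.FG := not_fg_of_normal P ρ.ker inferInstance hRP hR
      (by rw [hP, Subgroup.index_comap_of_surjective _ hρ, hDinf])
    obtain ⟨B, _, ⟨e⟩⟩ := exists_infinite_basis P hPfg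
    have : Group.FG D := (Group.fg_iff_subgroup_fg D).2 hDfg
    let ρD : P →* D := ρ.subgroupComap D
    have hρD : Function.Surjective ρD := by
      rintro ⟨d, hd⟩
      obtain ⟨x, rfl⟩ := hρ d
      exact ⟨⟨x, hd⟩, rfl⟩
    obtain ⟨κ, Θ, h1, h2⟩ := lift_through (ρD.comp e.toMonoidHom)
      (hρD.comp e.surjective) (SemidirectProduct.rightHom (N := D → L) (φ := mulAutArrow))
      SemidirectProduct.inr (fun d => by simp) ξ
    let Θ' : P →* ((D → L) ⋊[mulAutArrow] D) := Θ.comp e.symm.toMonoidHom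
    have hΘ' : ∀ p, (Θ' p).right = ρD p := by
      intro p
      have := h1 (e.symm p)
      simpa [Θ'] using this
    have hbase : Sat SU (SemidirectProduct.rightHom (N := D → L) (G := D)
        (φ := mulAutArrow)).ker := by
      let g : (SemidirectProduct.rightHom (N := D → L) (G := D) (φ := mulAutArrow)).ker →*
          (D → L) :=
        { toFun := fun x => x.1.left
          map_one' := rfl
          map_mul' := by
            rintro ⟨x, hx⟩ ⟨y, hy⟩
            have hx' : x.right = 1 := hx
            simp [hx'] }
      refine sat_of_inj g ?_ (sat_pi (fun _ => hL))
      rintro ⟨x, hx⟩ ⟨y, hy⟩ hxy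
      apply Subtype.ext
      have hx' : x.right = 1 := hx
      have hy' : y.right = 1 := hy
      exact SemidirectProduct.ext hxy (hx'.trans hy'.symm)
    have hkill : verb SU ρ.ker ≤ (Θ'.ker).map P.subtype := by
      rw [verb, Subgroup.closure_le]
      rintro _ ⟨w, hw, φ, rfl⟩
      refine ⟨Subgroup.inclusion hRP (φ w), ?_, rfl⟩
      let φ₂ : FreeGroup ℕ →* (SemidirectProduct.rightHom (N := D → L) (G := D)
          (φ := mulAutArrow)).ker :=
        (Θ'.comp ((Subgroup.inclusion hRP).comp φ)).codRestrict _ (by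
          intro x
          change (Θ' _).right = 1
          rw [hΘ']
          exact Subtype.ext (φ x).2)
      exact congrArg Subtype.val (hbase w hw φ₂)
    refine ⟨(QuotientGroup.mk' _).comp (P.subtype.comp (e.toMonoidHom.comp κ)), ?_⟩
    intro w hw hc
    have hmem : ((e (κ w) : P) : FreeGroup (Fin m)) ∈ verb SU ρ.ker :=
      (QuotientGroup.eq_one_iff _).1 hc
    obtain ⟨p, hp, hpe⟩ := hkill hmem
    have hp' : p = e (κ w) := Subtype.ext hpe
    apply hξ w hw
    rw [← h2]
    have : Θ' (e (κ w)) = 1 := hp' ▸ hp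
    simpa [Θ'] using this

theorem free_embeds (m : ℕ) (hm : 2 ≤ m) :
    ∃ f : FreeGroup ℕ →* FreeGroup (Fin m), Function.Injective f := by
  let deg : FreeGroup (Fin m) →* Multiplicative ℤ :=
    FreeGroup.lift (fun _ => Multiplicative.ofAdd 1)
  let a : Fin m := ⟨0, by omega⟩
  let b : Fin m := ⟨1, by omega⟩
  have hsurj : Function.Surjective deg := by
    intro z
    refine ⟨FreeGroup.of a ^ (Multiplicative.toAdd z), ?_⟩
    rw [map_zpow]
    simp only [deg, FreeGroup.lift_apply_of]
    rw [← ofAdd_zsmul]; simp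
  have hfg : ¬ deg.ker.FG := by
    refine not_fg_of_normal deg.ker deg.ker inferInstance le_rfl ?_ ?_
    · intro hc
      have h1 : FreeGroup.of a * (FreeGroup.of b)⁻¹ ∈ deg.ker := by
        rw [MonoidHom.mem_ker]; simp [deg]
      rw [hc, Subgroup.mem_bot, mul_inv_eq_one] at h1
      have := FreeGroup.of_injective h1
      simp [a, b] at this
    · rw [Subgroup.index_ker, MonoidHom.range_eq_top.2 hsurj]
      exact Nat.card_eq_zero_of_infinite
  obtain ⟨B, _, ⟨e⟩⟩ := exists_infinite_basis _ hfg
  refine ⟨(deg.ker.subtype.comp e.toMonoidHom).comp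
    (FreeGroup.map (Infinite.natEmbedding B)), ?_⟩
  exact (Subtype.val_injective.comp e.injective).comp
    (FreeGroup.map_injective (Infinite.natEmbedding B).injective)

theorem exists_surj {m : ℕ} {G : Type} [Group G] (h : GeneratedBy m G) :
    ∃ ρ : FreeGroup (Fin m) →* G, Function.Surjective ρ := by
  obtain ⟨s, hs, hcl⟩ := h
  let f : Fin m → G := fun i => s.toList.getD i 1
  refine ⟨FreeGroup.lift f, ?_⟩
  rw [← MonoidHom.range_eq_top, eq_top_iff, ← hcl, Subgroup.closure_le]
  intro x hx
  obtain ⟨n, hn, rfl⟩ := List.getElem_of_mem (Finset.mem_toList.2 hx)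
  have hn' : n < s.card := by simpa using hn
  exact ⟨FreeGroup.of ⟨n, by omega⟩, by simp [f, List.getElem?_eq_getElem hn]⟩

/-- If an `m`-generated group `G` (`m ≥ 2`) of the variety `V` contains a finitely
generated subgroup `D` of infinite index which discriminates the relatively free group
of `V`, then for any variety `U` the relatively free group of `U·V` is discriminated by
an `m`-generated group of `U·V`; in particular the basis rank of `U·V` is at most `m`. -/
theorem product_discriminated_by_m_generated
    (SV : Set (FreeGroup ℕ)) (m : ℕ) (hm : 2 ≤ m)
    (G : Type) [Group G] (hGgen : GeneratedBy m G) (hGV : Sat SV G)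
    (D : Subgroup G) (hDfg : D.FG) (hDinf : D.index = 0)
    (hdisc : ∀ W : Finset (FreeGroup ℕ), (∀ w ∈ W, ¬ IsIdOf SV w) →
      ∃ η : FreeGroup ℕ →* D, ∀ w ∈ W, η w ≠ 1)
    (SU : Set (FreeGroup ℕ)) :
    (∃ (H₀ : Type) (hH : Group H₀), haveI := hH;
      GeneratedBy m H₀ ∧ MemProd SU SV H₀ ∧
        ∀ W : Finset (FreeGroup ℕ), (∀ w ∈ W, ¬ IsIdOfProd SU SV w) →
          ∃ η : FreeGroup ℕ →* H₀, ∀ w ∈ W, η w ≠ 1) ∧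
    (∀ w : FreeGroup ℕ,
      (∀ (H : Type) [Group H], MemProd SU SV H → GeneratedBy m H →
          ∀ φ : FreeGroup ℕ →* H, φ w = 1) →
      ∀ (K : Type) [Group K], MemProd SU SV K → ∀ ψ : FreeGroup ℕ →* K, ψ w = 1) := by
  have main : (∃ (H₀ : Type) (hH : Group H₀), haveI := hH;
      GeneratedBy m H₀ ∧ MemProd SU SV H₀ ∧
        ∀ W : Finset (FreeGroup ℕ), (∀ w ∈ W, ¬ IsIdOfProd SU SV w) →
          ∃ η : FreeGroup ℕ →* H₀, ∀ w ∈ W, η w ≠ 1) := by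
    obtain ⟨ρ, hρ⟩ := exists_surj hGgen
    by_cases hR : ρ.ker = ⊥
    · have hinj : Function.Injective ρ := (MonoidHom.ker_eq_bot_iff ρ).1 hR
      obtain ⟨f, hf⟩ := free_embeds m hm
      have hF : Sat SV (FreeGroup ℕ) := sat_of_inj (ρ.comp f) (hinj.comp hf) hGV
      refine ⟨G, inferInstance, hGgen, memProd_of_hom (MonoidHom.id G) hGV ?_, ?_⟩
      · intro w _ φ
        exact Subtype.ext (φ w).2
      · intro W hW
        obtain ⟨η, hη⟩ := hdisc W (by
          intro w hw hid
          apply hW w hw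
          have h1 : w = 1 := hid (FreeGroup ℕ) hF (MonoidHom.id _)
          intro H _ _ φ
          rw [h1, map_one])
        refine ⟨D.subtype.comp η, fun w hw hc => hη w hw (Subtype.ext hc)⟩
    · exact case_rel SV m G hGV D hDfg hDinf hdisc SU ρ hρ hR
  refine ⟨main, ?_⟩
  intro w hw K _ hK ψ
  by_contra hc
  obtain ⟨H₀, _, hgen, hmem, hd⟩ := main
  obtain ⟨η, hη⟩ := hd {w} (by
    intro v hv hid
    rw [Finset.mem_singleton.1 hv] at hid
    exact hc (hid K hK ψ))
  exact hη w (by simp) (hw H₀ hmem hgen η)
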